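/- (Deterministic core of Theorem 2.) Let s ≥ 1, let A_i, C_i be real n×n matrices, B_i real n×p matrices and K_j real p×n matrices (1 ≤ i, j ≤ s), and set A_{ij} = A_i + B_i K_j. Let P_k (1 ≤ k ≤ s) be symmetric real n×n matrices, D a diagonal real n×n matrix and β ≥ 0 a real number such that each P_k + βD is positive semidefinite. Let Q̄_{ijk} (1 ≤ i, j, k ≤ s) be symmetric real n×n matrices with Q̄_{ijk} = Q̄_{jik}. Assume that for all i, j, k the matrix (P_k A_{ij})^S + C_iᵀ (P_k + βD) C_i + Q̄_{ijk} is negative definite, and that for each k the sn×sn block matrix with (i,j) block Q̄_{ijk} is positive definite. Then for every x ∈ ℝⁿ with x ≠ 0 and every h ∈ ℝ^s with h_i ≥ 0 and Σ_{i=1}^s h_i = 1, Σ_{i=1}^s Σ_{j=1}^s Σ_{k=1}^s Σ_{l=1}^s h_i h_j h_k h_l · xᵀ [ P_k A_{ij} + (1/2) C_iᵀ (P_k + βD) C_l ]^S x < 0. -/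

import Mathlib

open Matrix

theorem sum_mul_neg_of_convex_weights {ι : Type*} [Fintype ι] {h f : ι → ℝ}
    (h0 : ∀ i, 0 ≤ h i) (h1 : ∑ i, h i = 1) (hf : ∀ i, f i < 0) : ∑ i, h i * f i < 0 := by
  obtain ⟨i, -, hi⟩ : ∃ i ∈ Finset.univ, 0 < h i := by
    by_contra! hc
    linarith [Finset.sum_nonpos hc]
  exact Finset.sum_neg' (fun j _ => mul_nonpos_of_nonneg_of_nonpos (h0 j) (hf j).le)
    ⟨i, Finset.mem_univ i, mul_neg_of_pos_of_neg hi (hf i)⟩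

theorem sum_sum_mul_le_sum_diag {ι : Type*} [Fintype ι] {h : ι → ℝ}
    (h0 : ∀ i, 0 ≤ h i) (h1 : ∑ i, h i = 1) {q : ι → ι → ℝ}
    (hq : ∀ i l, 2 * q i l ≤ q i i + q l l) :
    ∑ i, ∑ l, h i * h l * q i l ≤ ∑ i, h i * q i i := by
  have hle : ∑ i, ∑ l, h i * h l * q i l
      ≤ ∑ i, ∑ l, (h i * q i i / 2 * h l + h i / 2 * (h l * q l l)) := by
    refine Finset.sum_le_sum fun i _ => Finset.sum_le_sum fun l _ => ?_
    nlinarith [mul_le_mul_of_nonneg_left (hq i l) (mul_nonneg (h0 i) (h0 l))]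
  refine hle.trans_eq ?_
  simp only [Finset.sum_add_distrib, ← Finset.mul_sum, ← Finset.sum_mul, ← Finset.sum_div, h1]
  ring

theorem quadruple_convex_sum_neg {ι : Type*} [Fintype ι] {h : ι → ℝ}
    (h0 : ∀ i, 0 ≤ h i) (h1 : ∑ i, h i = 1) {a r q : ι → ι → ι → ℝ}
    (hq : ∀ k i l, 2 * q k i l ≤ q k i i + q k l l)
    (hneg : ∀ i j k, a i j k + q k i i + r i j k < 0)
    (hr : ∀ k, 0 ≤ ∑ i, ∑ j, h i * h j * r i j k) :
    ∑ i, ∑ j, ∑ k, ∑ l, h i * h j * h k * h l * (a i j k + q k i l) < 0 := by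
  have hk : ∀ k, ∑ i, ∑ j, h i * h j * a i j k + ∑ i, ∑ l, h i * h l * q k i l < 0 := by
    intro k
    have hlt := sum_mul_neg_of_convex_weights h0 h1 fun i =>
      sum_mul_neg_of_convex_weights h0 h1 fun j => hneg i j k
    have heq : ∑ i, h i * ∑ j, h j * (a i j k + q k i i + r i j k)
        = ∑ i, ∑ j, h i * h j * a i j k + ∑ i, h i * q k i i
          + ∑ i, ∑ j, h i * h j * r i j k := by
      simp only [mul_add, Finset.sum_add_distrib, ← Finset.sum_mul, h1, one_mul,
        Finset.mul_sum, mul_assoc]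
    linarith [sum_sum_mul_le_sum_diag h0 h1 (hq k), hr k]
  refine lt_of_eq_of_lt ?_ (sum_mul_neg_of_convex_weights h0 h1 hk)
  have hinner : ∀ i j k, ∑ l, h i * h j * h k * h l * (a i j k + q k i l)
      = h k * (h i * h j * a i j k) + h k * (h j * ∑ l, h i * h l * q k i l) := by
    intro i j k
    calc _ = h i * h j * h k * a i j k * ∑ l, h l
          + h k * (h j * ∑ l, h i * h l * q k i l) := by
          simp only [Finset.mul_sum, ← Finset.sum_add_distrib]
          exact Finset.sum_congr rfl fun l _ => by ring
      _ = _ := by rw [h1]; ring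
  simp only [hinner]
  calc _ = ∑ k, ∑ i, ∑ j, (h k * (h i * h j * a i j k)
          + h k * (h j * ∑ l, h i * h l * q k i l)) := by
        rw [Finset.sum_comm]
        refine (Finset.sum_congr rfl fun j _ => Finset.sum_comm).trans ?_
        rw [Finset.sum_comm]
        exact Finset.sum_congr rfl fun k _ => Finset.sum_comm
    _ = _ := by
        simp only [Finset.sum_add_distrib, ← Finset.mul_sum, ← Finset.sum_mul, h1, one_mul, mul_add]

theorem dotProduct_mulVec_transpose_self {ι : Type*} [Fintype ι]
    (M : Matrix ι ι ℝ) (x : ι → ℝ) : x ⬝ᵥ (Mᵀ *ᵥ x) = x ⬝ᵥ (M *ᵥ x) := by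
  rw [mulVec_transpose, dotProduct_comm, dotProduct_mulVec]

theorem Matrix.PosSemidef.two_mul_dotProduct_mulVec_le {ι : Type*} [Fintype ι]
    {M : Matrix ι ι ℝ} (hM : M.PosSemidef) (y z : ι → ℝ) :
    2 * (y ⬝ᵥ (M *ᵥ z)) ≤ y ⬝ᵥ (M *ᵥ y) + z ⬝ᵥ (M *ᵥ z) := by
  have hnn := hM.dotProduct_mulVec_nonneg (y - z)
  have hsymm : z ⬝ᵥ (M *ᵥ y) = y ⬝ᵥ (M *ᵥ z) := by
    have ht : Mᵀ = M := by simpa [conjTranspose_eq_transpose_of_trivial] using hM.isHermitian.eq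
    rw [dotProduct_comm, ← vecMul_transpose, ht, ← dotProduct_mulVec]
  simp only [star_trivial, mulVec_sub, dotProduct_sub, sub_dotProduct] at hnn
  linarith

theorem dotProduct_transpose_mul_mul_mulVec {ι κ : Type*} [Fintype ι] [Fintype κ]
    (C E : Matrix κ ι ℝ) (M : Matrix κ κ ℝ) (x : ι → ℝ) :
    x ⬝ᵥ ((Cᵀ * M * E) *ᵥ x) = (C *ᵥ x) ⬝ᵥ (M *ᵥ (E *ᵥ x)) := by
  rw [← mulVec_mulVec, ← mulVec_mulVec, dotProduct_mulVec, vecMul_transpose]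

theorem block_dotProduct_mulVec {ι κ : Type*} [Fintype ι] [Fintype κ]
    (Q : ι → ι → Matrix κ κ ℝ) (h : ι → ℝ) (x : κ → ℝ) :
    (fun p : ι × κ => h p.1 * x p.2) ⬝ᵥ
        ((Matrix.of fun p q : ι × κ => Q p.1 q.1 p.2 q.2) *ᵥ fun p => h p.1 * x p.2)
      = ∑ i, ∑ j, h i * h j * (x ⬝ᵥ (Q i j *ᵥ x)) := by
  simp only [dotProduct, mulVec, Fintype.sum_prod_type, Matrix.of_apply, Finset.mul_sum]
  refine Finset.sum_congr rfl fun i _ => ?_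
  rw [Finset.sum_comm]
  exact Finset.sum_congr rfl fun j _ => Finset.sum_congr rfl fun b _ =>
    Finset.sum_congr rfl fun c _ => by ring

/-- Deterministic core of Theorem 2: with `A_{ij} = A_i + B_i K_j`, under
`(P_k A_{ij})^S + C_iᵀ(P_k + βD)C_i + Q̄_{ijk} < 0` and positivity of each
block matrix `(Q̄_{ijk})_{ij}`, one has
`∑_{i,j,k,l} h_i h_j h_k h_l xᵀ[P_k A_{ij} + ½ C_iᵀ(P_k + βD)C_l]^S x < 0`
for all `x ≠ 0` and convex-combination vectors `h`. -/
theorem stmt_17 (n p s : ℕ) (hs : 1 ≤ s)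
    (A C : Fin s → Matrix (Fin n) (Fin n) ℝ)
    (B : Fin s → Matrix (Fin n) (Fin p) ℝ)
    (K : Fin s → Matrix (Fin p) (Fin n) ℝ)
    (Acl : Fin s → Fin s → Matrix (Fin n) (Fin n) ℝ)
    (hAcl : ∀ i j, Acl i j = A i + B i * K j)
    (P : Fin s → Matrix (Fin n) (Fin n) ℝ) (hP : ∀ k, (P k)ᵀ = P k)
    (d : Fin n → ℝ) (β : ℝ) (hβ : 0 ≤ β)
    (hPD : ∀ k, (P k + β • Matrix.diagonal d).PosSemidef)
    (Q : Fin s → Fin s → Fin s → Matrix (Fin n) (Fin n) ℝ)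
    (hQsymm : ∀ i j k, (Q i j k)ᵀ = Q i j k) (hQswap : ∀ i j k, Q i j k = Q j i k)
    (hneg : ∀ i j k, (-(P k * Acl i j + (P k * Acl i j)ᵀ
        + (C i)ᵀ * (P k + β • Matrix.diagonal d) * C i + Q i j k)).PosDef)
    (hΘ : ∀ k, (Matrix.of fun p' q' : Fin s × Fin n => Q p'.1 q'.1 k p'.2 q'.2).PosDef) :
    ∀ (x : Fin n → ℝ), x ≠ 0 → ∀ h : Fin s → ℝ, (∀ i, 0 ≤ h i) → (∑ i, h i = 1) →
      ∑ i, ∑ j, ∑ k, ∑ l, h i * h j * h k * h l *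
          (x ⬝ᵥ ((P k * Acl i j + (1/2 : ℝ) • ((C i)ᵀ * (P k + β • Matrix.diagonal d) * C l)
            + (P k * Acl i j
              + (1/2 : ℝ) • ((C i)ᵀ * (P k + β • Matrix.diagonal d) * C l))ᵀ).mulVec x))
        < 0 := by
  intro x hx h h0 h1
  have key := quadruple_convex_sum_neg h0 h1
    (a := fun i j k => 2 * (x ⬝ᵥ ((P k * Acl i j) *ᵥ x)))
    (r := fun i j k => x ⬝ᵥ (Q i j k *ᵥ x))
    (q := fun k i l => (C i *ᵥ x) ⬝ᵥ ((P k + β • Matrix.diagonal d) *ᵥ (C l *ᵥ x)))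
    (fun k i l => (hPD k).two_mul_dotProduct_mulVec_le _ _)
    (fun i j k => by
      have hpos := (hneg i j k).dotProduct_mulVec_pos hx
      rw [star_trivial, neg_mulVec, dotProduct_neg] at hpos
      rw [add_mulVec, add_mulVec, add_mulVec, dotProduct_add, dotProduct_add, dotProduct_add,
        dotProduct_mulVec_transpose_self, dotProduct_transpose_mul_mul_mulVec] at hpos
      linarith)
    (fun k => by
      rw [← block_dotProduct_mulVec (fun i j => Q i j k) h x]
      simpa only [star_trivial] using
        (hΘ k).posSemidef.dotProduct_mulVec_nonneg fun p : Fin s × Fin n => h p.1 * x p.2)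
  refine lt_of_eq_of_lt ?_ key
  refine Finset.sum_congr rfl fun i _ => Finset.sum_congr rfl fun j _ =>
    Finset.sum_congr rfl fun k _ => Finset.sum_congr rfl fun l _ => ?_
  congr 1
  rw [add_mulVec, dotProduct_add, dotProduct_mulVec_transpose_self, add_mulVec, dotProduct_add,
    smul_mulVec, dotProduct_smul, dotProduct_transpose_mul_mul_mulVec, smul_eq_mul]
  ring
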